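/- Fix p0 ∈ (0,2) and γ ∈ (0,1). For every bounded measurable function ρ : [p0,2] → ℝ, the map α ↦ ∫_{p0}^2 |ρ(p) − R_α(p)|^γ dp is continuous on [0,2]; consequently, it attains its minimum on [0,2] and its set of minimizers is a nonempty closed subset of [0,2]. -/

import Mathlib

open MeasureTheory Real Set

/-- `m_α(p)`: the `p`-th absolute moment of a standard symmetric `α`-stable random
variable, `m_α(p) = 2^(p−1) Γ(1 − p/α) / (p ∫_0^∞ u^(−p−1) sin²(u) du)`. -/
noncomputable def mstable (a p : ℝ) : ℝ :=
  2 ^ (p - 1) * Real.Gamma (1 - p / a) /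
    (p * ∫ u in Set.Ioi (0:ℝ), u ^ (-p - 1) * Real.sin u ^ 2)

/-- `R_α(p) = (m_α(p0))^{1/p0} / (m_α(p))^{1/p}` if `p < α`, and `0` otherwise. -/
noncomputable def Rstable (p0 a p : ℝ) : ℝ :=
  if p < a then mstable a p0 ^ (1 / p0) / mstable a p ^ (1 / p) else 0

/-- The contrast function `α ↦ ∫_{p0}^2 |ρ(p) − R_α(p)|^γ dp`. -/
noncomputable def contrastG (p0 γ : ℝ) (ρ : ℝ → ℝ) (a : ℝ) : ℝ :=
  ∫ p in p0..2, |ρ p - Rstable p0 a p| ^ γ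

lemma Gamma_bds : ∃ c C : ℝ, 0 < c ∧ 0 < C ∧ ∀ t ∈ Set.Icc (1:ℝ) 2, c ≤ Real.Gamma t ∧ Real.Gamma t ≤ C := by
  have hc : ContinuousOn Real.Gamma (Set.Icc (1:ℝ) 2) := fun t ht =>
    (Real.differentiableAt_Gamma (fun m => by
      have : (0:ℝ) ≤ m := Nat.cast_nonneg m
      have := ht.1
      linarith)).continuousAt.continuousWithinAt
  have hne : (Set.Icc (1:ℝ) 2).Nonempty := ⟨1, by norm_num⟩
  obtain ⟨x, hx, hx'⟩ := isCompact_Icc.exists_isMinOn hne hc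
  obtain ⟨z, hz, hz'⟩ := isCompact_Icc.exists_isMaxOn hne hc
  refine ⟨Real.Gamma x, Real.Gamma z, Real.Gamma_pos_of_pos (by linarith [hx.1]),
    Real.Gamma_pos_of_pos (by linarith [hz.1]), fun t ht => ⟨hx' ht, hz' ht⟩⟩

lemma sinInt_nonneg (p : ℝ) :
    0 ≤ ∫ u in Set.Ioi (0:ℝ), u ^ (-p - 1) * Real.sin u ^ 2 :=
  setIntegral_nonneg measurableSet_Ioi fun u hu =>
    mul_nonneg (Real.rpow_nonneg (le_of_lt hu) _) (sq_nonneg _)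

lemma sinInt_le {p : ℝ} (hp : 0 < p) (hp2 : p < 2) :
    p * ∫ u in Set.Ioi (0:ℝ), u ^ (-p - 1) * Real.sin u ^ 2 ≤ 2 / (2 - p) := by
  set g : ℝ → ℝ := fun u => if u ≤ 1 then u ^ (1 - p) else u ^ (-p - 1) with hg
  have h1 : IntegrableOn (fun u : ℝ => u ^ (1 - p)) (Set.Ioc 0 1) := by
    have := (intervalIntegral.intervalIntegrable_rpow' (a := 0) (b := 1) (r := 1 - p) (by linarith))
    rwa [intervalIntegrable_iff_integrableOn_Ioc_of_le zero_le_one] at this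
  have h2 : IntegrableOn (fun u : ℝ => u ^ (-p - 1)) (Set.Ioi 1) :=
    integrableOn_Ioi_rpow_of_lt (by linarith) one_pos
  have e1 : EqOn (fun u : ℝ => u ^ (1 - p)) g (Set.Ioc 0 1) := fun u hu => by
    simp [hg, hu.2]
  have e2 : EqOn (fun u : ℝ => u ^ (-p - 1)) g (Set.Ioi 1) := fun u hu => by
    have : ¬ u ≤ 1 := not_le.2 hu
    simp [hg, this]
  have g1 := h1.congr_fun e1 measurableSet_Ioc
  have g2 := h2.congr_fun e2 measurableSet_Ioi
  have hU : Set.Ioc (0:ℝ) 1 ∪ Set.Ioi 1 = Set.Ioi 0 := Set.Ioc_union_Ioi_eq_Ioi zero_le_one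
  have hgi : IntegrableOn g (Set.Ioi 0) := by
    rw [← hU]; exact g1.union g2
  have hle : ∫ u in Set.Ioi (0:ℝ), u ^ (-p - 1) * Real.sin u ^ 2 ≤ ∫ u in Set.Ioi (0:ℝ), g u := by
    apply integral_mono_of_nonneg
    · filter_upwards [ae_restrict_mem measurableSet_Ioi] with u hu
      exact mul_nonneg (Real.rpow_nonneg (le_of_lt hu) _) (sq_nonneg _)
    · exact hgi
    · filter_upwards [ae_restrict_mem measurableSet_Ioi] with u hu
      have hu' : 0 < u := hu
      have hn := Real.rpow_nonneg hu'.le (-p - 1)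
      by_cases h : u ≤ 1
      · have : g u = u ^ (-p - 1) * u ^ 2 := by
          simp only [hg, h, if_true]
          rw [← Real.rpow_natCast u 2, ← Real.rpow_add hu']
          congr 1; push_cast; ring
        rw [this]
        apply mul_le_mul_of_nonneg_left _ hn
        rw [sq_le_sq]
        exact (Real.abs_sin_le_abs).trans le_rfl
      · simp only [hg, h, if_false]
        exact mul_le_of_le_one_right hn (Real.sin_sq_le_one u)
  have hval : ∫ u in Set.Ioi (0:ℝ), g u = 1 / (2 - p) + 1 / p := by
    rw [← hU, setIntegral_union (Set.Ioc_disjoint_Ioi le_rfl) measurableSet_Ioi g1 g2,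
      ← setIntegral_congr_fun measurableSet_Ioc e1, ← setIntegral_congr_fun measurableSet_Ioi e2,
      integral_Ioi_rpow_of_lt (by linarith) one_pos,
      ← intervalIntegral.integral_of_le zero_le_one, integral_rpow (Or.inl (by linarith))]
    rw [Real.zero_rpow (by linarith)]
    have : -p - 1 + 1 = -p := by ring
    rw [this]
    have : 1 - p + 1 = 2 - p := by ring
    rw [this]
    simp
  rw [hval] at hle
  have hd : 0 < 2 - p := by linarith
  calc _ ≤ p * (1 / (2 - p) + 1 / p) := mul_le_mul_of_nonneg_left hle hp.le
    _ = 2 / (2 - p) := by field_simp; ring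

lemma Rstable_nonneg {p0 a p : ℝ} (hp0 : 0 < p0) (h : p0 < p) : 0 ≤ Rstable p0 a p := by
  unfold Rstable
  split_ifs with hpa
  · have ha : 0 < a := by linarith
    have aux : ∀ q, 0 < q → q < a → 0 ≤ mstable a q := fun q hq hqa => by
      unfold mstable
      have : 0 < 1 - q / a := by rw [sub_pos, div_lt_one ha]; exact hqa
      have := Real.Gamma_pos_of_pos this
      have := sinInt_nonneg q
      positivity
    exact div_nonneg (Real.rpow_nonneg (aux _ hp0 (by linarith)) _)
      (Real.rpow_nonneg (aux _ (by linarith) (by linarith)) _)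
  · exact le_rfl

lemma Rstable_bdd {p0 : ℝ} (hp0 : 0 < p0) (hp2 : p0 < 2) :
    ∃ B : ℝ, ∀ a ≤ 2, ∀ p, p0 < p → |Rstable p0 a p| ≤ B := by
  obtain ⟨c, C, hc, hC, hG⟩ := Gamma_bds
  set I0 := p0 * ∫ u in Set.Ioi (0:ℝ), u ^ (-p0 - 1) * Real.sin u ^ 2 with hI0
  have hI0n : 0 ≤ I0 := mul_nonneg hp0.le (sinInt_nonneg p0)
  set E := (2 ^ (p0 - 1) / I0 * C) ^ (1 / p0) with hE
  have hEn : 0 ≤ E := by positivity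
  set F := (max 1 (4 / (c * (2 - p0)))) with hF
  have hF1 : 1 ≤ F := le_max_left _ _
  have hBn : 0 ≤ E * (F ^ (1 / p0) * Real.exp (2 / p0 ^ 2)) := by positivity
  refine ⟨E * (F ^ (1 / p0) * Real.exp (2 / p0 ^ 2)), fun a ha2 p hp => ?_⟩
  rw [abs_of_nonneg (Rstable_nonneg hp0 hp)]
  unfold Rstable
  split_ifs with hpa
  swap
  · exact hBn
  have hp' : 0 < p := by linarith
  have ha : 0 < a := by linarith
  have h2p0 : 0 < 2 - p0 := by linarith
  have h2p : 0 < 2 - p := by linarith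
  set x := 1 - p0 / a with hx
  set y := 1 - p / a with hy
  have hy0 : 0 < y := by rw [hy, sub_pos, div_lt_one ha]; exact hpa
  have hx0 : 0 < x := by rw [hx, sub_pos, div_lt_one ha]; linarith
  have hx1 : x < 1 := by have : 0 < p0 / a := by positivity
                         linarith
  have hy1 : y < 1 := by have : 0 < p / a := by positivity
                         linarith
  have hgx : Real.Gamma x ≤ C / x := by
    rw [le_div_iff₀ hx0, mul_comm, ← Real.Gamma_add_one hx0.ne']
    exact (hG _ ⟨by linarith, by linarith⟩).2
  have hgy : c / y ≤ Real.Gamma y := by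
    rw [div_le_iff₀ hy0, mul_comm, ← Real.Gamma_add_one hy0.ne']
    exact (hG _ ⟨by linarith, by linarith⟩).1
  have hgx0 := Real.Gamma_pos_of_pos hx0
  have hgy0 := Real.Gamma_pos_of_pos hy0
  -- numerator
  have hnum : mstable a p0 ^ (1 / p0) ≤ E * (x ^ (1 / p0))⁻¹ := by
    rw [hE, ← Real.inv_rpow hx0.le, ← Real.mul_rpow (by positivity) (by positivity)]
    have : mstable a p0 = 2 ^ (p0 - 1) / I0 * Real.Gamma x := by
      unfold mstable; rw [← hI0, ← hx]; ring
    rw [this, mul_assoc, ← div_eq_mul_inv]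
    gcongr
  -- denominator
  set I := p * ∫ u in Set.Ioi (0:ℝ), u ^ (-p - 1) * Real.sin u ^ 2 with hI
  have hIn : 0 ≤ I := mul_nonneg hp'.le (sinInt_nonneg p)
  have hIle : I ≤ 2 / (2 - p) := sinInt_le hp' (by linarith)
  have hxy : y / (2 - p) ≤ x / (2 - p0) := by
    rw [div_le_div_iff₀ h2p h2p0]
    have e1 : y = (a - p) / a := by rw [hy]; field_simp
    have e2 : x = (a - p0) / a := by rw [hx]; field_simp
    rw [e1, e2, div_mul_eq_mul_div, div_mul_eq_mul_div]
    gcongr ?_ / _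
    nlinarith
  have hmi : (mstable a p)⁻¹ ≤ F * x := by
    have : (mstable a p)⁻¹ = I * (2 ^ (p - 1))⁻¹ * (Real.Gamma y)⁻¹ := by
      unfold mstable; rw [← hI, ← hy, inv_div, div_eq_mul_inv, mul_inv, ← mul_assoc]
    rw [this]
    have t1 : ((2:ℝ) ^ (p - 1))⁻¹ ≤ 2 := by
      rw [← Real.rpow_neg (by norm_num)]
      calc (2:ℝ) ^ (-(p - 1)) ≤ 2 ^ (1:ℝ) := Real.rpow_le_rpow_of_exponent_le (by norm_num) (by linarith)
        _ = 2 := by simp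
    have t2 : (Real.Gamma y)⁻¹ ≤ y / c := by
      rw [← inv_div]; exact inv_anti₀ (by positivity) hgy
    calc I * (2 ^ (p - 1))⁻¹ * (Real.Gamma y)⁻¹ ≤ 2 / (2 - p) * 2 * (y / c) := by gcongr
      _ = 4 / c * (y / (2 - p)) := by field_simp; ring
      _ ≤ 4 / c * (x / (2 - p0)) := by gcongr
      _ = 4 / (c * (2 - p0)) * x := by field_simp
      _ ≤ F * x := by gcongr; exact le_max_right _ _
  have hmn : 0 ≤ mstable a p := by
    unfold mstable; rw [← hI, ← hy]; positivity
  have hexp : x ^ (1 / p) ≤ x ^ (1 / p0) * Real.exp (2 / p0 ^ 2) := by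
    have : 1 / p = 1 / p0 + (1 / p - 1 / p0) := by ring
    rw [this, Real.rpow_add hx0]
    gcongr
    rw [Real.rpow_def_of_pos hx0]
    apply Real.exp_le_exp.2
    have l1 : -Real.log x ≤ x⁻¹ := by
      rw [← Real.log_inv]
      linarith [Real.log_le_sub_one_of_pos (inv_pos.2 hx0)]
    have l0 : 0 ≤ -Real.log x := by linarith [Real.log_neg hx0 hx1]
    have l2 : 1 / p0 - 1 / p ≤ 2 * x / p0 ^ 2 := by
      have : 1 / p0 - 1 / p = (p - p0) / (p0 * p) := by field_simp
      rw [this]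
      have hax : a * x = a - p0 := by rw [hx]; field_simp
      have : p - p0 ≤ 2 * x := by nlinarith
      calc (p - p0) / (p0 * p) ≤ 2 * x / (p0 * p0) := by gcongr
        _ = _ := by ring
    calc Real.log x * (1 / p - 1 / p0) = (1 / p0 - 1 / p) * (-Real.log x) := by ring
      _ ≤ 2 * x / p0 ^ 2 * x⁻¹ := by gcongr
      _ = 2 / p0 ^ 2 := by field_simp
  have hden : (mstable a p ^ (1 / p))⁻¹ ≤ F ^ (1 / p0) * (x ^ (1 / p0) * Real.exp (2 / p0 ^ 2)) := by
    rw [← Real.inv_rpow hmn]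
    calc (mstable a p)⁻¹ ^ (1 / p) ≤ (F * x) ^ (1 / p) := by
          apply Real.rpow_le_rpow (inv_nonneg.2 hmn) hmi (by positivity)
      _ = F ^ (1 / p) * x ^ (1 / p) := Real.mul_rpow (by positivity) hx0.le
      _ ≤ _ := by
        gcongr
  have hxp : 0 < x ^ (1 / p0) := Real.rpow_pos_of_pos hx0 _
  rw [div_eq_mul_inv]
  calc _ ≤ E * (x ^ (1 / p0))⁻¹ * (F ^ (1 / p0) * (x ^ (1 / p0) * Real.exp (2 / p0 ^ 2))) := by
        gcongr
        
    _ = _ := by field_simp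

lemma mstable_contAt {a q : ℝ} (hq : 0 < q) (hqa : q < a) :
    ContinuousAt (fun b => mstable b q) a := by
  have ha : 0 < a := by linarith
  unfold mstable
  have hpos : 0 < 1 - q / a := by rw [sub_pos, div_lt_one ha]; exact hqa
  have hG : ContinuousAt Real.Gamma (1 - q / a) :=
    (Real.differentiableAt_Gamma (fun m => by
      have : (0:ℝ) ≤ m := Nat.cast_nonneg m
      linarith)).continuousAt
  have h1 : ContinuousAt (fun b : ℝ => 1 - q / b) a :=
    continuousAt_const.sub (continuousAt_const.div continuousAt_id ha.ne')
  have h2 : ContinuousAt (fun b : ℝ => Real.Gamma (1 - q / b)) a :=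
    ContinuousAt.comp (f := fun b : ℝ => 1 - q / b) hG h1
  exact (continuousAt_const.mul h2).div_const _

lemma Rstable_contAt {p0 a p : ℝ} (hp0 : 0 < p0) (hp : p0 < p) (hne : p ≠ a) :
    ContinuousAt (fun b => Rstable p0 b p) a := by
  have hp' : 0 < p := by linarith
  rcases lt_or_gt_of_ne hne with h | h
  · have hev : (fun b => Rstable p0 b p) =ᶠ[nhds a]
        fun b => mstable b p0 ^ (1 / p0) / mstable b p ^ (1 / p) := by
      filter_upwards [lt_mem_nhds h] with b hb
      simp [Rstable, hb]
    refine ContinuousAt.congr ?_ hev.symm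
    have n1 := (mstable_contAt hp0 (hp.trans h)).rpow_const (p := 1 / p0) (Or.inr (by positivity))
    have n2 := (mstable_contAt hp' h).rpow_const (p := 1 / p) (Or.inr (by positivity))
    by_cases hI : (∫ u in Set.Ioi (0:ℝ), u ^ (-p - 1) * Real.sin u ^ 2) = 0
    · have : ∀ b, mstable b p = 0 := fun b => by simp [mstable, hI]
      have hz : (0:ℝ) ^ (1 / p) = 0 := Real.zero_rpow (by positivity)
      simp only [this, hz, div_zero]
      exact continuousAt_const
    · refine n1.div n2 ?_
      have hI' := lt_of_le_of_ne (sinInt_nonneg p) (Ne.symm hI)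
      have hpos : 0 < 1 - p / a := by rw [sub_pos, div_lt_one (by linarith)]; exact h
      have hg := Real.Gamma_pos_of_pos hpos
      have : 0 < mstable a p := by unfold mstable; positivity
      exact (Real.rpow_pos_of_pos this _).ne'
  · have hev : (fun b => Rstable p0 b p) =ᶠ[nhds a] fun _ => 0 := by
      filter_upwards [gt_mem_nhds h] with b hb
      have : ¬ p < b := not_lt.2 hb.le
      simp [Rstable, this]
    exact continuousAt_const.congr hev.symm

lemma Rstable_aesm {p0 : ℝ} (hp0 : 0 < p0) (a : ℝ) :
    AEMeasurable (Rstable p0 a) (volume.restrict (Set.Ioc p0 2)) := by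
  classical
  set G : ℝ → ℝ := (Set.Ioi (0:ℝ)).piecewise Real.Gamma (fun _ => 0) with hGd
  have hG : Measurable G := by
    apply ContinuousOn.measurable_piecewise _ continuousOn_const measurableSet_Ioi
    intro t ht
    have ht' : 0 < t := ht
    exact (Real.differentiableAt_Gamma (fun m => by
      have : (0:ℝ) ≤ m := Nat.cast_nonneg m
      linarith)).continuousAt.continuousWithinAt
  have hI : Measurable (fun p : ℝ => ∫ u in Set.Ioi (0:ℝ), u ^ (-p - 1) * Real.sin u ^ 2) := by
    have hm : Measurable (fun z : ℝ × ℝ => z.2 ^ (-z.1 - 1) * Real.sin z.2 ^ 2) := by fun_prop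
    exact (hm.stronglyMeasurable.integral_prod_right'
      (ν := volume.restrict (Set.Ioi (0:ℝ)))).measurable
  set N : ℝ → ℝ := fun p => if p < a then mstable a p0 ^ (1 / p0) /
    (2 ^ (p - 1) * G (1 - p / a) /
      (p * ∫ u in Set.Ioi (0:ℝ), u ^ (-p - 1) * Real.sin u ^ 2)) ^ (1 / p) else 0 with hN
  have hNm : Measurable N := by
    apply Measurable.ite measurableSet_Iio _ measurable_const
    have : Measurable (fun p : ℝ => G (1 - p / a)) := hG.comp (by fun_prop)
    have h2 : Measurable (fun p : ℝ => (2:ℝ) ^ (p - 1)) := by fun_prop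
    exact measurable_const.div
      (((h2.mul this).div (measurable_id.mul hI)).pow (measurable_const.div measurable_id))
  refine ⟨N, hNm, ?_⟩
  filter_upwards [ae_restrict_mem measurableSet_Ioc] with p hp
  simp only [Rstable, hN]
  split_ifs with h
  · have : G (1 - p / a) = Real.Gamma (1 - p / a) := by
      apply Set.piecewise_eq_of_mem
      show 0 < 1 - p / a
      rw [sub_pos, div_lt_one (by linarith [hp.1])]
      exact h
    rw [this]; rfl
  · rfl

lemma contrastG_cont (p0 γ : ℝ)
    (hp0 : p0 ∈ Set.Ioo (0:ℝ) 2) (hγ : γ ∈ Set.Ioo (0:ℝ) 1)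
    (ρ : ℝ → ℝ) (hρmeas : Measurable ρ) (hρbd : ∃ M : ℝ, ∀ p ∈ Set.Icc p0 2, |ρ p| ≤ M) :
    ContinuousOn (contrastG p0 γ ρ) (Set.Icc 0 2) := by
  obtain ⟨M, hM⟩ := hρbd
  obtain ⟨B, hB⟩ := Rstable_bdd hp0.1 hp0.2
  intro a ha
  unfold contrastG
  apply intervalIntegral.continuousWithinAt_of_dominated_interval (bound := fun _ => (M + B) ^ γ)
  · refine Filter.Eventually.of_forall fun b => ?_
    rw [Set.uIoc_of_le hp0.2.le]
    have h1 : AEMeasurable (fun p => ρ p - Rstable p0 b p) (volume.restrict (Set.Ioc p0 2)) :=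
      hρmeas.aemeasurable.sub (Rstable_aesm hp0.1 b)
    have h2 : Measurable (fun t : ℝ => |t| ^ γ) := by fun_prop
    exact (h2.comp_aemeasurable h1).aestronglyMeasurable
  · filter_upwards [self_mem_nhdsWithin] with b hb
    refine Filter.Eventually.of_forall fun p hp => ?_
    rw [Set.uIoc_of_le hp0.2.le] at hp
    rw [Real.norm_eq_abs, abs_of_nonneg (by positivity)]
    apply Real.rpow_le_rpow (abs_nonneg _) _ hγ.1.le
    exact (abs_sub _ _).trans (add_le_add (hM p ⟨hp.1.le, hp.2⟩) (hB b hb.2 p hp.1))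
  · exact intervalIntegrable_const
  · have : ∀ᵐ p : ℝ, p ≠ a := by
      simp [ae_iff]
    filter_upwards [this] with p hpa hp
    rw [Set.uIoc_of_le hp0.2.le] at hp
    exact (((continuousAt_const.sub (Rstable_contAt hp0.1 hp.1 hpa)).abs).rpow_const
      (Or.inr hγ.1.le)).continuousWithinAt

/-- Fix `p0 ∈ (0,2)` and `γ ∈ (0,1)`.  For every bounded measurable
`ρ : [p0,2] → ℝ`, the map `α ↦ ∫_{p0}^2 |ρ(p) − R_α(p)|^γ dp` is continuous on `[0,2]`;
consequently it attains its minimum on `[0,2]`, and its set of minimizers is a nonempty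
closed subset of `[0,2]`. -/
theorem contrast_function_continuous_and_argmin_closed (p0 γ : ℝ)
    (hp0 : p0 ∈ Set.Ioo (0:ℝ) 2) (hγ : γ ∈ Set.Ioo (0:ℝ) 1)
    (ρ : ℝ → ℝ) (hρmeas : Measurable ρ) (hρbd : ∃ M : ℝ, ∀ p ∈ Set.Icc p0 2, |ρ p| ≤ M) :
    ContinuousOn (contrastG p0 γ ρ) (Set.Icc 0 2) ∧
    (∃ a ∈ Set.Icc (0:ℝ) 2, ∀ b ∈ Set.Icc (0:ℝ) 2, contrastG p0 γ ρ a ≤ contrastG p0 γ ρ b) ∧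
    {a | a ∈ Set.Icc (0:ℝ) 2 ∧
        ∀ b ∈ Set.Icc (0:ℝ) 2, contrastG p0 γ ρ a ≤ contrastG p0 γ ρ b}.Nonempty ∧
    IsClosed {a | a ∈ Set.Icc (0:ℝ) 2 ∧
        ∀ b ∈ Set.Icc (0:ℝ) 2, contrastG p0 γ ρ a ≤ contrastG p0 γ ρ b} := by
  have hc := contrastG_cont p0 γ hp0 hγ ρ hρmeas hρbd
  have hmin : ∃ a ∈ Set.Icc (0:ℝ) 2, ∀ b ∈ Set.Icc (0:ℝ) 2,
      contrastG p0 γ ρ a ≤ contrastG p0 γ ρ b := by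
    obtain ⟨a, ha, h⟩ := isCompact_Icc.exists_isMinOn ⟨0, by norm_num⟩ hc
    exact ⟨a, ha, fun b hb => h hb⟩
  refine ⟨hc, hmin, hmin, ?_⟩
  obtain ⟨a, ha, h⟩ := hmin
  have := hc.preimage_isClosed_of_isClosed isClosed_Icc
    (isClosed_Iic (a := contrastG p0 γ ρ a))
  convert this using 1
  ext b
  simp only [Set.mem_setOf_eq, Set.mem_inter_iff, Set.mem_preimage, Set.mem_Iic]
  exact ⟨fun hb => ⟨hb.1, hb.2 a ha⟩, fun hb => ⟨hb.1, fun d hd => hb.2.trans (h d hd)⟩⟩
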